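/- There exists a sequence of graphs G_n on n vertices whose transition graphs 𝒢(G_n) are connected but have diameter Ω(n²); explicitly, for every k ≥ 1 the spider's web W_k on n = 6k vertices has a connected transition graph 𝒢(W_k) whose diameter is at least n(n − 2)/12. -/

import Mathlib

/-- The spider's web graph `W_k` on the vertices `Fin k × ZMod 6` (vertex
`(i, j)` corresponds to `u_{i+1, j+1}`): `k` concentric hexagons joined by
spokes, plus the extra edge `u_{1,1}u_{1,4}`. -/
def Web (k : ℕ) : SimpleGraph (Fin k × ZMod 6) :=
  SimpleGraph.fromRel fun x y =>
    (x.1 = y.1 ∧ y.2 = x.2 + 1) ∨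
    (x.2 = y.2 ∧ (y.1 : ℕ) = (x.1 : ℕ) + 1) ∨
    ((x.1 : ℕ) = 0 ∧ (y.1 : ℕ) = 0 ∧ x.2 = 0 ∧ y.2 = 3)

/-- For `p ∈ {1, 2}`, the perfect matching `M_p` of `W_k` consisting of the
hexagon edges `u_{i,j}u_{i,j+1}` with `i + j ≡ p - 1 (mod 2)` (in the paper's
1-based indexing; here vertex `(i, j)` is `u_{i+1, j+1}`). -/
def WebM (k p : ℕ) : Set (Sym2 (Fin k × ZMod 6)) :=
  {e | ∃ (i : Fin k) (j : ZMod 6),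
    ((i : ℕ) + j.val) % 2 = (p - 1) % 2 ∧ e = s((i, j), (i, j + 1))}

/-- A perfect matching of `G`, viewed as a set of edges: a set of pairwise
disjoint edges of `G` covering every vertex. -/
def IsPM {V : Type*} (G : SimpleGraph V) (M : Set (Sym2 V)) : Prop :=
  M ⊆ G.edgeSet ∧
    (∀ e ∈ M, ∀ f ∈ M, e ≠ f → ∀ v : V, ¬(v ∈ e ∧ v ∈ f)) ∧
    (∀ v : V, ∃ e ∈ M, v ∈ e)

/-- Two perfect matchings differ by a switch. -/
def IsSwitch {V : Type*} (G : SimpleGraph V) (M M' : Set (Sym2 V)) : Prop :=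
  ∃ u v u' v' : V, u ≠ v ∧ u ≠ u' ∧ u ≠ v' ∧ v ≠ u' ∧ v ≠ v' ∧ u' ≠ v' ∧
    s(u, v) ∈ M ∧ s(u', v') ∈ M ∧ G.Adj u' v ∧ G.Adj u v' ∧
    M' = (M \ {s(u, v), s(u', v')}) ∪ {s(u', v), s(u, v')}

/-- The transition graph of the switch chain on `G`: vertices are the perfect
matchings of `G`, two of them adjacent iff they differ by a switch. -/
def TransGraph {V : Type*} (G : SimpleGraph V) :
    SimpleGraph {M : Set (Sym2 V) // IsPM G M} :=
  SimpleGraph.fromRel fun M N => IsSwitch G M.1 N.1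

/-- exactly one of four propositions -/
def ExOne (a b c d : Prop) : Prop :=
  (a ∨ b ∨ c ∨ d) ∧ ¬(a ∧ b) ∧ ¬(a ∧ c) ∧ ¬(a ∧ d) ∧ ¬(b ∧ c) ∧ ¬(b ∧ d) ∧ ¬(c ∧ d)

def StEmpty (Y : ZMod 6 → Prop) : Prop := ¬ Y 0 ∧ ¬ Y 1 ∧ ¬ Y 2 ∧ ¬ Y 3 ∧ ¬ Y 4 ∧ ¬ Y 5

def StA (Y R : ZMod 6 → Prop) (a : ZMod 6) : Prop :=
  ¬ Y a ∧ Y (a+1) ∧ Y (a+2) ∧ ¬ Y (a+3) ∧ ¬ Y (a+4) ∧ ¬ Y (a+5) ∧ R (a+3) ∧ R (a+5)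

def StB (Y R : ZMod 6 → Prop) (a : ZMod 6) : Prop :=
  ¬ Y a ∧ Y (a+1) ∧ ¬ Y (a+2) ∧ ¬ Y (a+3) ∧ Y (a+4) ∧ ¬ Y (a+5) ∧ R (a+5)

def StInv (Y R : ZMod 6 → Prop) : Prop :=
  StEmpty Y ∨ (StA Y R 0 ∨ StA Y R 2 ∨ StA Y R 4) ∨ (StB Y R 0 ∨ StB Y R 2 ∨ StB Y R 4)

theorem step_empty (Y R Y' : ZMod 6 → Prop)
    (cov : ∀ t, ExOne (R t) (R (t-1)) (Y t) (Y' (t+1)))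
    (ha : ∀ s, s = 0 ∨ s = 2 ∨ s = 4 → ¬ (Y s ∧ Y (s+1)))
    (h : StEmpty Y') : StInv Y R := by
  have c0 : ExOne (R 0) (R 5) (Y 0) (Y' 1) := cov 0
  have c1 : ExOne (R 1) (R 0) (Y 1) (Y' 2) := cov 1
  have c2 : ExOne (R 2) (R 1) (Y 2) (Y' 3) := cov 2
  have c3 : ExOne (R 3) (R 2) (Y 3) (Y' 4) := cov 3
  have c4 : ExOne (R 4) (R 3) (Y 4) (Y' 5) := cov 4
  have c5 : ExOne (R 5) (R 4) (Y 5) (Y' 0) := cov 5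
  have a0 : ¬ (Y 0 ∧ Y 1) := ha 0 (by simp)
  have a2 : ¬ (Y 2 ∧ Y 3) := ha 2 (by simp)
  have a4 : ¬ (Y 4 ∧ Y 5) := ha 4 (by simp)
  have eA0 : StA Y R 0 ↔ (¬ Y 0 ∧ Y 1 ∧ Y 2 ∧ ¬ Y 3 ∧ ¬ Y 4 ∧ ¬ Y 5 ∧ R 3 ∧ R 5) := Iff.rfl
  have eA2 : StA Y R 2 ↔ (¬ Y 2 ∧ Y 3 ∧ Y 4 ∧ ¬ Y 5 ∧ ¬ Y 0 ∧ ¬ Y 1 ∧ R 5 ∧ R 1) := Iff.rfl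
  have eA4 : StA Y R 4 ↔ (¬ Y 4 ∧ Y 5 ∧ Y 0 ∧ ¬ Y 1 ∧ ¬ Y 2 ∧ ¬ Y 3 ∧ R 1 ∧ R 3) := Iff.rfl
  have eB0 : StB Y R 0 ↔ (¬ Y 0 ∧ Y 1 ∧ ¬ Y 2 ∧ ¬ Y 3 ∧ Y 4 ∧ ¬ Y 5 ∧ R 5) := Iff.rfl
  have eB2 : StB Y R 2 ↔ (¬ Y 2 ∧ Y 3 ∧ ¬ Y 4 ∧ ¬ Y 5 ∧ Y 0 ∧ ¬ Y 1 ∧ R 1) := Iff.rfl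
  have eB4 : StB Y R 4 ↔ (¬ Y 4 ∧ Y 5 ∧ ¬ Y 0 ∧ ¬ Y 1 ∧ Y 2 ∧ ¬ Y 3 ∧ R 3) := Iff.rfl
  rw [StInv, eA0, eA2, eA4, eB0, eB2, eB4]
  clear cov ha eA0 eA2 eA4 eB0 eB2 eB4
  unfold StEmpty ExOne at *
  generalize R 0 = r0, R 1 = r1, R 2 = r2, R 3 = r3, R 4 = r4, R 5 = r5,
    Y 0 = y0, Y 1 = y1, Y 2 = y2, Y 3 = y3, Y 4 = y4, Y 5 = y5,
    Y' 0 = z0, Y' 1 = z1, Y' 2 = z2, Y' 3 = z3, Y' 4 = z4, Y' 5 = z5 at *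
  obtain ⟨h0, h1, h2, h3, h4, h5⟩ := h
  by_cases r0 <;> by_cases r1 <;> by_cases r2 <;> by_cases r3 <;> by_cases r4 <;> by_cases r5 <;>
    simp_all

theorem ev2 : ∀ a : ZMod 6, a = 0 ∨ a = 2 ∨ a = 4 → a + 2 = 0 ∨ a + 2 = 2 ∨ a + 2 = 4 := by decide

theorem ev4 : ∀ a : ZMod 6, a = 0 ∨ a = 2 ∨ a = 4 → a + 4 = 0 ∨ a + 4 = 2 ∨ a + 4 = 4 := by decide

theorem step_A (Y R Y' R' : ZMod 6 → Prop) (a : ZMod 6)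
    (cov : ∀ t, ExOne (R t) (R (t-1)) (Y t) (Y' (t+1)))
    (ha : ∀ s, s = 0 ∨ s = 2 ∨ s = 4 → ¬ (Y s ∧ Y (s+1)))
    (hb : ∀ s, s = 0 ∨ s = 2 ∨ s = 4 → ¬ (R s ∧ R' (s+1)))
    (hs : a = 0 ∨ a = 2 ∨ a = 4)
    (h : StA Y' R' a) : StB Y R (a+4) := by
  have a2 : ¬ (Y (a+2) ∧ Y (a+3)) := by
    have := ha (a+2) (ev2 a hs)
    rwa [add_assoc] at this
  have a4 : ¬ (Y (a+4) ∧ Y (a+5)) := by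
    have := ha (a+4) (ev4 a hs)
    rwa [add_assoc] at this
  have b2 : ¬ (R (a+2) ∧ R' (a+3)) := by
    have := hb (a+2) (ev2 a hs)
    rwa [add_assoc] at this
  have b4 : ¬ (R (a+4) ∧ R' (a+5)) := by
    have := hb (a+4) (ev4 a hs)
    rwa [add_assoc] at this
  have key : ∀ b c d : ZMod 6, b - 1 = c → b + 1 = d →
      ExOne (R (a+b)) (R (a+c)) (Y (a+b)) (Y' (a+d)) := by
    rintro b c d rfl rfl
    have := cov (a+b)
    rwa [add_assoc, add_sub_assoc] at this
  have c0 := key 0 5 1 rfl rfl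
  have c1 := key 1 0 2 rfl rfl
  have c2 := key 2 1 3 rfl rfl
  have c3 := key 3 2 4 rfl rfl
  have c4 := key 4 3 5 rfl rfl
  have c5 := key 5 4 0 rfl rfl
  simp only [add_zero] at c0 c1 c5
  unfold StB
  have e : ∀ b c : ZMod 6, 4 + b = c → a + 4 + b = a + c := by
    rintro b c rfl; rw [add_assoc]
  rw [e 1 5 rfl, e 2 0 rfl, e 3 1 rfl, e 4 2 rfl, e 5 3 rfl, add_zero]
  unfold StA at h
  clear cov ha hb hs key e
  unfold ExOne at *
  generalize R a = r0, R (a+1) = r1, R (a+2) = r2, R (a+3) = r3, R (a+4) = r4, R (a+5) = r5,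
    Y a = y0, Y (a+1) = y1, Y (a+2) = y2, Y (a+3) = y3, Y (a+4) = y4, Y (a+5) = y5,
    Y' a = z0, Y' (a+1) = z1, Y' (a+2) = z2, Y' (a+3) = z3, Y' (a+4) = z4, Y' (a+5) = z5 at *
  obtain ⟨h0, h1, h2, h3, h4, h5, h6, h7⟩ := h
  by_cases r2 <;> by_cases r3 <;> by_cases r4 <;> simp_all

theorem step_B (Y R Y' R' : ZMod 6 → Prop) (a : ZMod 6)
    (cov : ∀ t, ExOne (R t) (R (t-1)) (Y t) (Y' (t+1)))
    (ha : ∀ s, s = 0 ∨ s = 2 ∨ s = 4 → ¬ (Y s ∧ Y (s+1)))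
    (hb : ∀ s, s = 0 ∨ s = 2 ∨ s = 4 → ¬ (R s ∧ R' (s+1)))
    (hs : a = 0 ∨ a = 2 ∨ a = 4)
    (h : StB Y' R' a) : False := by
  have a4 : ¬ (Y (a+4) ∧ Y (a+5)) := by
    have := ha (a+4) (ev4 a hs)
    rwa [add_assoc] at this
  have b4 : ¬ (R (a+4) ∧ R' (a+5)) := by
    have := hb (a+4) (ev4 a hs)
    rwa [add_assoc] at this
  have key : ∀ b c d : ZMod 6, b - 1 = c → b + 1 = d →
      ExOne (R (a+b)) (R (a+c)) (Y (a+b)) (Y' (a+d)) := by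
    rintro b c d rfl rfl
    have := cov (a+b)
    rwa [add_assoc, add_sub_assoc] at this
  have c0 := key 0 5 1 rfl rfl
  have c3 := key 3 2 4 rfl rfl
  have c4 := key 4 3 5 rfl rfl
  have c5 := key 5 4 0 rfl rfl
  simp only [add_zero] at c0 c5
  unfold StB at h
  clear cov ha hb hs key
  unfold ExOne at *
  obtain ⟨h0, h1, h2, h3, h4, h5, h6⟩ := h
  generalize R a = r0, R (a+1) = r1, R (a+2) = r2, R (a+3) = r3, R (a+4) = r4, R (a+5) = r5,
    Y a = y0, Y (a+1) = y1, Y (a+2) = y2, Y (a+3) = y3, Y (a+4) = y4, Y (a+5) = y5,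
    Y' a = z0, Y' (a+1) = z1, Y' (a+2) = z2, Y' (a+3) = z3, Y' (a+4) = z4, Y' (a+5) = z5 at *
  simp_all

/-- The combinatorial heart: a configuration without raising flips is the top one. -/
theorem noflip_top (k : ℕ) (R Y : ℕ → ZMod 6 → Prop)
    (cov : ∀ i < k, ∀ t, ExOne (R i t) (R i (t-1)) (Y i t) (Y (i+1) (t+1)))
    (hk : ∀ t, ¬ Y k t)
    (ha : ∀ i, ∀ s, s = 0 ∨ s = 2 ∨ s = 4 → ¬ (Y i s ∧ Y i (s+1)))
    (hb : ∀ i, ∀ s, s = 0 ∨ s = 2 ∨ s = 4 → ¬ (R i s ∧ R (i+1) (s+1)))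
    (h1 : ¬ Y 0 1) (h4 : ¬ Y 0 4) (h5 : ¬ Y 0 5)
    (hc : ¬ (R 0 1 ∧ Y 0 0)) (hd : ¬ (R 0 3 ∧ R 0 5)) :
    ∀ i < k, ∀ s, s = 0 ∨ s = 2 ∨ s = 4 → R i s := by
  have step : ∀ i < k, StInv (Y (i+1)) (R (i+1)) →
      StInv (Y i) (R i) ∧ (StEmpty (Y i) → StEmpty (Y (i+1))) := by
    intro i hi h
    have hB : ∀ b, StB (Y i) (R i) b → ¬ StEmpty (Y i) := by
      rintro b hb ⟨e0, e1, e2, e3, e4, e5⟩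
      have : ∀ t, ¬ Y i t := by
        intro t; fin_cases t <;> assumption
      exact this _ hb.2.1
    rcases h with h | (h | h | h) | (h | h | h)
    · exact ⟨step_empty _ _ _ (cov i hi) (ha i) h, fun _ => h⟩
    · have := step_A _ _ _ _ 0 (cov i hi) (ha i) (hb i) (by simp) h
      exact ⟨Or.inr (Or.inr (Or.inr (Or.inr this))), fun e => absurd e (hB _ this)⟩
    · have := step_A _ _ _ _ 2 (cov i hi) (ha i) (hb i) (by simp) h
      exact ⟨Or.inr (Or.inr (Or.inl this)), fun e => absurd e (hB _ this)⟩
    · have := step_A _ _ _ _ 4 (cov i hi) (ha i) (hb i) (by simp) h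
      exact ⟨Or.inr (Or.inr (Or.inr (Or.inl this))), fun e => absurd e (hB _ this)⟩
    · exact (step_B _ _ _ _ 0 (cov i hi) (ha i) (hb i) (by simp) h).elim
    · exact (step_B _ _ _ _ 2 (cov i hi) (ha i) (hb i) (by simp) h).elim
    · exact (step_B _ _ _ _ 4 (cov i hi) (ha i) (hb i) (by simp) h).elim
  have inv : ∀ n, n ≤ k → StInv (Y (k-n)) (R (k-n)) := by
    intro n
    induction n with
    | zero => intro _; exact Or.inl ⟨hk _, hk _, hk _, hk _, hk _, hk _⟩
    | succ n ih =>
      intro hn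
      have e : k - (n+1) + 1 = k - n := by omega
      refine (step (k-(n+1)) (by omega) ?_).1
      rw [e]; exact ih (by omega)
  have inv' : ∀ i, i ≤ k → StInv (Y i) (R i) := by
    intro i hi
    have := inv (k-i) (by omega)
    rwa [Nat.sub_sub_self hi] at this
  have emp0 : StEmpty (Y 0) := by
    rcases inv' 0 (Nat.zero_le _) with h | (h | h | h) | (h | h | h)
    · exact h
    · exact absurd h.2.1 h1
    · exact absurd h.2.2.1 h4
    · exact absurd h.2.1 h5
    · exact absurd h.2.1 h1
    · have e0 : Y 0 0 := h.2.2.2.2.1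
      have e1 : R 0 1 := h.2.2.2.2.2.2
      exact absurd ⟨e1, e0⟩ hc
    · exact absurd h.2.1 h5
  have emp : ∀ i, i ≤ k → StEmpty (Y i) := by
    intro i
    induction i with
    | zero => intro _; exact emp0
    | succ i ih =>
      intro hi
      exact (step i (by omega) (inv' (i+1) hi)).2 (ih (by omega))
  have empt : ∀ i, i ≤ k → ∀ t, ¬ Y i t := by
    intro i hi t
    obtain ⟨e0, e1, e2, e3, e4, e5⟩ := emp i hi
    fin_cases t <;> assumption
  have alt : ∀ i < k, ∀ t, R i (t-1) ↔ ¬ R i t := by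
    intro i hi t
    have h := cov i hi t
    have n1 := empt i hi.le t
    have n2 := empt (i+1) hi (t+1)
    unfold ExOne at h
    clear cov hk ha hb h1 h4 h5 hc hd step inv inv' emp0 emp empt
    tauto
  have alts : ∀ i < k, R i 0 → ∀ s, s = 0 ∨ s = 2 ∨ s = 4 → R i s := by
    intro i hi h0 s hs
    have a1 : R i 0 ↔ ¬ R i 1 := alt i hi 1
    have a2 : R i 1 ↔ ¬ R i 2 := alt i hi 2
    have a3 : R i 2 ↔ ¬ R i 3 := alt i hi 3
    have a4 : R i 3 ↔ ¬ R i 4 := alt i hi 4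
    clear cov hk ha hb h1 h4 h5 hc hd step inv inv' emp0 emp empt alt
    rcases hs with rfl | rfl | rfl <;> tauto
  intro i
  induction i with
  | zero =>
    intro hi
    refine alts 0 hi ?_
    have a1 : R 0 5 ↔ ¬ R 0 0 := alt 0 hi 0
    have a5 : R 0 4 ↔ ¬ R 0 5 := alt 0 hi 5
    have a4 : R 0 3 ↔ ¬ R 0 4 := alt 0 hi 4
    by_contra h
    exact hd ⟨a4.2 fun h4 => a5.1 h4 (a1.2 h), a1.2 h⟩
  | succ i ih =>
    intro hi
    refine alts (i+1) hi ?_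
    have h0 := ih (by omega) 0 (by simp)
    have a1 : R (i+1) 0 ↔ ¬ R (i+1) 1 := alt (i+1) hi 1
    have b : ¬ (R i 0 ∧ R (i+1) 1) := hb i 0 (by simp)
    exact a1.2 fun h => b ⟨h0, h⟩

theorem pm_unique {V : Type*} {G : SimpleGraph V} {M : Set (Sym2 V)} (h : IsPM G M)
    {e f : Sym2 V} (he : e ∈ M) (hf : f ∈ M) {x : V} (hx : x ∈ e) (hy : x ∈ f) : e = f := by
  by_contra hne
  exact h.2.1 e he f hf hne x ⟨hx, hy⟩

theorem pm_unique' {V : Type*} {G : SimpleGraph V} {M : Set (Sym2 V)} (h : IsPM G M)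
    {x a b : V} (he : s(x, a) ∈ M) (hf : s(x, b) ∈ M) : a = b := by
  have := pm_unique h he hf (x := x) (by simp) (by simp)
  rcases Sym2.eq_iff.1 this with h | h
  · exact h.2
  · rw [h.2, h.1]

theorem pm_subset_eq {V : Type*} {G : SimpleGraph V} {M N : Set (Sym2 V)} (hM : IsPM G M)
    (hN : IsPM G N) (h : N ⊆ M) : N = M := by
  apply Set.Subset.antisymm h
  intro e he
  induction e with
  | h x y =>
    obtain ⟨f, hf, hx⟩ := hN.2.2 x
    have := pm_unique hM he (h hf) (x := x) (by simp) hx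
    rwa [this]

theorem switch_isPM {V : Type*} {G : SimpleGraph V} {M : Set (Sym2 V)} (h : IsPM G M)
    {u v u' v' : V} (h1 : u ≠ v) (h2 : u ≠ u') (h3 : u ≠ v') (h4 : v ≠ u') (h5 : v ≠ v')
    (h6 : u' ≠ v') (m1 : s(u, v) ∈ M) (m2 : s(u', v') ∈ M) (a1 : G.Adj u' v) (a2 : G.Adj u v') :
    IsPM G ((M \ {s(u, v), s(u', v')}) ∪ {s(u', v), s(u, v')}) := by
  have old : ∀ e ∈ M \ {s(u, v), s(u', v')}, u ∉ e ∧ v ∉ e ∧ u' ∉ e ∧ v' ∉ e := by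
    rintro e ⟨he, hn⟩
    simp only [Set.mem_insert_iff, Set.mem_singleton_iff, not_or] at hn
    refine ⟨fun hx => hn.1 ?_, fun hx => hn.1 ?_, fun hx => hn.2 ?_, fun hx => hn.2 ?_⟩
    · exact pm_unique h he m1 hx (by simp)
    · exact pm_unique h he m1 hx (by simp)
    · exact pm_unique h he m2 hx (by simp)
    · exact pm_unique h he m2 hx (by simp)
  have new : ∀ e ∈ ({s(u', v), s(u, v')} : Set (Sym2 V)), ∀ x ∈ e,
      x = u ∨ x = v ∨ x = u' ∨ x = v' := by
    rintro e he x hx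
    simp only [Set.mem_insert_iff, Set.mem_singleton_iff] at he
    rcases he with rfl | rfl <;> simp only [Sym2.mem_iff] at hx <;> tauto
  have on : ∀ e ∈ M \ {s(u, v), s(u', v')}, ∀ f ∈ ({s(u', v), s(u, v')} : Set (Sym2 V)),
      ∀ x, ¬ (x ∈ e ∧ x ∈ f) := by
    rintro e he f hf x ⟨hxe, hxf⟩
    obtain ⟨o1, o2, o3, o4⟩ := old e he
    rcases new f hf x hxf with rfl | rfl | rfl | rfl <;> contradiction
  refine ⟨?_, ?_, ?_⟩
  · rintro e (he | he)
    · exact h.1 he.1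
    · simp only [Set.mem_insert_iff, Set.mem_singleton_iff] at he
      rcases he with rfl | rfl
      · exact a1
      · exact a2
  · rintro e (he | he) f (hf | hf) hne x
    · exact h.2.1 e he.1 f hf.1 hne x
    · exact on e he f hf x
    · intro hx; exact on f hf e he x hx.symm
    · simp only [Set.mem_insert_iff, Set.mem_singleton_iff] at he hf
      rintro ⟨hx, hy⟩
      rcases he with rfl | rfl <;> rcases hf with rfl | rfl
      · exact hne rfl
      · simp only [Sym2.mem_iff] at hx hy
        rcases hx with rfl | rfl <;> rcases hy with rfl | rfl <;> contradiction
      · simp only [Sym2.mem_iff] at hx hy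
        rcases hx with rfl | rfl <;> rcases hy with rfl | rfl <;> contradiction
      · exact hne rfl
  · intro x
    obtain ⟨e, he, hx⟩ := h.2.2 x
    by_cases hn : e ∈ ({s(u, v), s(u', v')} : Set (Sym2 V))
    · simp only [Set.mem_insert_iff, Set.mem_singleton_iff] at hn
      rcases hn with rfl | rfl
      · simp only [Sym2.mem_iff] at hx
        rcases hx with rfl | rfl
        · exact ⟨s(x, v'), by simp, by simp⟩
        · exact ⟨s(u', x), by simp, by simp⟩
      · simp only [Sym2.mem_iff] at hx
        rcases hx with rfl | rfl
        · exact ⟨s(x, v), by simp, by simp⟩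
        · exact ⟨s(u, x), by simp, by simp⟩
    · exact ⟨e, Or.inl ⟨he, hn⟩, hx⟩

/-- Bipartition sign. -/
def sgn {k : ℕ} (x : Fin k × ZMod 6) : ℤ := (-1) ^ (x.1.val + x.2.val)

/-- The hexagon edge starting at `x`. -/
def ringE {k : ℕ} (x : Fin k × ZMod 6) : Sym2 (Fin k × ZMod 6) := s(x, (x.1, x.2 + 1))

/-- The weight of the hexagon edge starting at `x`. -/
def rw8 {k : ℕ} (x : Fin k × ZMod 6) : ℤ := sgn x * (1 + 3 * (x.1.val : ℤ))

open Classical in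
/-- The weight of an edge. -/
noncomputable def wt {k : ℕ} (e : Sym2 (Fin k × ZMod 6)) : ℤ :=
  ∑ x : Fin k × ZMod 6, if ringE x = e then rw8 x else 0

open Classical in
/-- The potential of a matching. -/
noncomputable def pot {k : ℕ} (M : Set (Sym2 (Fin k × ZMod 6))) : ℤ :=
  ∑ x : Fin k × ZMod 6, if ringE x ∈ M then rw8 x else 0

theorem zne2 : ∀ a : ZMod 6, a + 1 + 1 ≠ a := by decide
theorem zne1 : ∀ a : ZMod 6, a + 1 ≠ a := by decide

theorem ringE_inj {k : ℕ} {x y : Fin k × ZMod 6} : ringE x = ringE y ↔ x = y := by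
  constructor
  · intro h
    rcases Sym2.eq_iff.1 h with h | h
    · exact h.1
    · exfalso
      have h1 := congrArg Prod.snd h.1
      have h2 := congrArg Prod.snd h.2
      simp only at h1 h2
      rw [h1] at h2
      exact zne2 _ h2
  · rintro rfl; rfl

theorem wt_ring {k : ℕ} (x : Fin k × ZMod 6) : wt (ringE x) = rw8 x := by
  unfold wt
  simp [ringE_inj]

theorem wt_zero {k : ℕ} (e : Sym2 (Fin k × ZMod 6)) (h : ∀ x, ringE x ≠ e) : wt e = 0 := by
  unfold wt
  simp [h]

theorem wt_spoke {k : ℕ} (x y : Fin k × ZMod 6) (h : x.1 ≠ y.1) : wt s(x, y) = 0 := by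
  apply wt_zero
  intro z hz
  rcases Sym2.eq_iff.1 hz with h' | h'
  · rw [← h'.1, ← h'.2] at h; exact h rfl
  · rw [← h'.1, ← h'.2] at h; exact h rfl

theorem wt_chord {k : ℕ} (x y : Fin k × ZMod 6) (h : x.2 = 0) (h' : y.2 = 3) :
    wt s(x, y) = 0 := by
  apply wt_zero
  intro z hz
  rcases Sym2.eq_iff.1 hz with e | e
  · have e1 := congrArg Prod.snd e.1
    have e2 := congrArg Prod.snd e.2
    simp only at e1 e2
    rw [e1, h, h'] at e2
    revert e2; decide
  · have e1 := congrArg Prod.snd e.1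
    have e2 := congrArg Prod.snd e.2
    simp only at e1 e2
    rw [e1, h, h'] at e2
    revert e2; decide

theorem pot_switch {k : ℕ} {G : SimpleGraph (Fin k × ZMod 6)}
    {M : Set (Sym2 (Fin k × ZMod 6))} (h : IsPM G M)
    {u v u' v' : Fin k × ZMod 6} (h1 : u ≠ v) (h2 : u ≠ u') (h3 : u ≠ v') (h5 : v ≠ v')
    (m1 : s(u, v) ∈ M) (m2 : s(u', v') ∈ M) :
    pot ((M \ {s(u, v), s(u', v')}) ∪ {s(u', v), s(u, v')}) =
      pot M - wt s(u, v) - wt s(u', v') + wt s(u', v) + wt s(u, v') := by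
  have n1 : s(u', v) ∉ M := by
    intro hm
    rw [Sym2.eq_swap] at hm m1
    exact h2 (pm_unique' h m1 hm)
  have n2 : s(u, v') ∉ M := fun hm => h5 (pm_unique' h m1 hm)
  have d1 : s(u, v) ≠ s(u', v') := by
    intro hm
    rcases Sym2.eq_iff.1 hm with e | e
    · exact h2 e.1
    · exact h3 e.1
  have d2 : s(u', v) ≠ s(u, v') := by
    intro hm
    rcases Sym2.eq_iff.1 hm with e | e
    · exact h2 e.1.symm
    · exact h1 e.2.symm
  unfold pot wt
  rw [← Finset.sum_sub_distrib, ← Finset.sum_sub_distrib, ← Finset.sum_add_distrib,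
    ← Finset.sum_add_distrib]
  apply Finset.sum_congr rfl
  intro x _
  generalize ringE x = e
  by_cases c1 : e = s(u, v)
  · have c2 : e ≠ s(u', v') := by rw [c1]; exact d1
    have c3 : e ≠ s(u', v) := by rintro rfl; rw [c1] at n1; exact n1 m1
    have c4 : e ≠ s(u, v') := by rintro rfl; rw [c1] at n2; exact n2 m1
    have cM : e ∈ M := by rw [c1]; exact m1
    simp only [Set.mem_union, Set.mem_sdiff, Set.mem_insert_iff, Set.mem_singleton_iff,
      eq_true c1, eq_false c2, eq_false c3, eq_false c4, eq_true cM]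
    simp
  by_cases c2 : e = s(u', v')
  · have c3 : e ≠ s(u', v) := by rintro rfl; rw [c2] at n1; exact n1 m2
    have c4 : e ≠ s(u, v') := by rintro rfl; rw [c2] at n2; exact n2 m2
    have cM : e ∈ M := by rw [c2]; exact m2
    simp only [Set.mem_union, Set.mem_sdiff, Set.mem_insert_iff, Set.mem_singleton_iff,
      eq_false c1, eq_true c2, eq_false c3, eq_false c4, eq_true cM]
    simp
  by_cases c3 : e = s(u', v)
  · have c4 : e ≠ s(u, v') := by rw [c3]; exact d2
    have cM : e ∉ M := by rw [c3]; exact n1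
    simp only [Set.mem_union, Set.mem_sdiff, Set.mem_insert_iff, Set.mem_singleton_iff,
      eq_false c1, eq_false c2, eq_true c3, eq_false c4, eq_false cM]
    simp
  by_cases c4 : e = s(u, v')
  · have cM : e ∉ M := by rw [c4]; exact n2
    simp only [Set.mem_union, Set.mem_sdiff, Set.mem_insert_iff, Set.mem_singleton_iff,
      eq_false c1, eq_false c2, eq_false c3, eq_true c4, eq_false cM]
    simp
  have hm : e ∈ (M \ {s(u, v), s(u', v')}) ∪ {s(u', v), s(u, v')} ↔ e ∈ M := by
    simp only [Set.mem_union, Set.mem_sdiff, Set.mem_insert_iff, Set.mem_singleton_iff,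
      eq_false c1, eq_false c2, eq_false c3, eq_false c4]
    tauto
  rw [if_neg c1, if_neg c2, if_neg c3, if_neg c4]
  by_cases cM : e ∈ M
  · rw [if_pos (hm.2 cM), if_pos cM]; ring
  · rw [if_neg (fun h => cM (hm.1 h)), if_neg cM]; ring

theorem web_adj {k : ℕ} {x y : Fin k × ZMod 6} (h : (Web k).Adj x y) :
    (x.1 = y.1 ∧ y.2 = x.2 + 1) ∨ (x.1 = y.1 ∧ x.2 = y.2 + 1) ∨
    (x.2 = y.2 ∧ (y.1 : ℕ) = (x.1 : ℕ) + 1) ∨ (x.2 = y.2 ∧ (x.1 : ℕ) = (y.1 : ℕ) + 1) ∨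
    ((x.1 : ℕ) = 0 ∧ (y.1 : ℕ) = 0 ∧ x.2 = 0 ∧ y.2 = 3) ∨
    ((x.1 : ℕ) = 0 ∧ (y.1 : ℕ) = 0 ∧ x.2 = 3 ∧ y.2 = 0) := by
  unfold Web at h
  rw [SimpleGraph.fromRel_adj] at h
  obtain ⟨_, (h | h | h) | (h | h | h)⟩ := h
  · tauto
  · tauto
  · tauto
  · exact Or.inr (Or.inl ⟨h.1.symm, h.2⟩)
  · exact Or.inr (Or.inr (Or.inr (Or.inl ⟨h.1.symm, h.2⟩)))
  · tauto

theorem adj_ring {k : ℕ} (x : Fin k × ZMod 6) : (Web k).Adj x (x.1, x.2 + 1) := by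
  unfold Web
  rw [SimpleGraph.fromRel_adj]
  refine ⟨fun h => zne1 x.2 (congrArg Prod.snd h).symm, Or.inl (Or.inl ⟨rfl, rfl⟩)⟩

theorem adj_spoke {k : ℕ} (x y : Fin k × ZMod 6) (h1 : x.2 = y.2)
    (h2 : (y.1 : ℕ) = (x.1 : ℕ) + 1) : (Web k).Adj x y := by
  unfold Web
  rw [SimpleGraph.fromRel_adj]
  refine ⟨fun h => ?_, Or.inl (Or.inr (Or.inl ⟨h1, h2⟩))⟩
  rw [h] at h2; omega

theorem adj_chord {k : ℕ} (x y : Fin k × ZMod 6) (h1 : (x.1 : ℕ) = 0) (h2 : (y.1 : ℕ) = 0)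
    (h3 : x.2 = 0) (h4 : y.2 = 3) : (Web k).Adj x y := by
  unfold Web
  rw [SimpleGraph.fromRel_adj]
  refine ⟨fun h => ?_, Or.inl (Or.inr (Or.inr ⟨h1, h2, h3, h4⟩))⟩
  rw [h, h4] at h3; revert h3; decide

theorem pow_val_succ : ∀ j : ZMod 6, (-1 : ℤ) ^ (j + 1).val = - (-1) ^ j.val := by decide

theorem sgn_sq {k : ℕ} (x : Fin k × ZMod 6) : sgn x * sgn x = 1 := by
  unfold sgn
  rw [← mul_pow]; simp

theorem sgn_cases {k : ℕ} (x : Fin k × ZMod 6) : sgn x = 1 ∨ sgn x = -1 :=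
  neg_one_pow_eq_or ℤ _

theorem sgn_ring {k : ℕ} (x y : Fin k × ZMod 6) (h : x.1 = y.1) (h' : y.2 = x.2 + 1) :
    sgn y = - sgn x := by
  unfold sgn
  rw [h, h', pow_add, pow_add, pow_val_succ]; ring

theorem sgn_spoke {k : ℕ} (x y : Fin k × ZMod 6) (h : x.2 = y.2)
    (h' : (y.1 : ℕ) = (x.1 : ℕ) + 1) : sgn y = - sgn x := by
  unfold sgn
  rw [h, h']; ring

theorem sgn_chord {k : ℕ} (x y : Fin k × ZMod 6) (h1 : (x.1 : ℕ) = 0) (h2 : (y.1 : ℕ) = 0)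
    (h3 : x.2 = 0) (h4 : y.2 = 3) : sgn x = 1 ∧ sgn y = -1 := by
  unfold sgn
  rw [h1, h2, h3, h4]; decide

theorem adj_form {k : ℕ} {x y : Fin k × ZMod 6} (h : (Web k).Adj x y) :
    ∃ d c : ℤ, y.2 = x.2 + ((d + 3 * c : ℤ) : ZMod 6) ∧ sgn y = - sgn x ∧
      ((d = 1 ∧ c = 0 ∧ (y.1 : ℤ) = (x.1 : ℤ) ∧ sgn x * wt s(x, y) = 1 + 3 * (x.1 : ℤ)) ∨
       (d = -1 ∧ c = 0 ∧ (y.1 : ℤ) = (x.1 : ℤ) ∧ sgn x * wt s(x, y) = -(1 + 3 * (x.1 : ℤ))) ∨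
       (d = 0 ∧ c = 0 ∧ (y.1 : ℤ) = (x.1 : ℤ) + 1 ∧ sgn x * wt s(x, y) = 0) ∨
       (d = 0 ∧ c = 0 ∧ (x.1 : ℤ) = (y.1 : ℤ) + 1 ∧ sgn x * wt s(x, y) = 0) ∨
       (d = 0 ∧ c = 1 ∧ (x.1 : ℤ) = 0 ∧ (y.1 : ℤ) = 0 ∧ sgn x * wt s(x, y) = 0)) := by
  rcases web_adj h with h | h | h | h | h | h
  · refine ⟨1, 0, by simpa using h.2, sgn_ring x y h.1 h.2, Or.inl ⟨rfl, rfl, by rw [h.1], ?_⟩⟩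
    have : s(x, y) = ringE x := by
      unfold ringE; congr 1; rw [h.1, ← h.2]
    rw [this, wt_ring, rw8, ← mul_assoc, sgn_sq, one_mul]
  · have hs := sgn_ring y x h.1.symm h.2
    refine ⟨-1, 0, by simp [h.2], by rw [hs, neg_neg],
      Or.inr (Or.inl ⟨rfl, rfl, by rw [h.1], ?_⟩)⟩
    have : s(x, y) = ringE y := by
      rw [Sym2.eq_swap]; unfold ringE; congr 1; rw [← h.1, ← h.2]
    rw [this, wt_ring, rw8, hs, ← mul_assoc, neg_mul, sgn_sq, h.1]; ring
  · refine ⟨0, 0, by simp [h.1], sgn_spoke x y h.1 h.2, Or.inr (Or.inr (Or.inl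
      ⟨rfl, rfl, by rw [h.2]; push_cast; rfl, ?_⟩))⟩
    rw [wt_spoke, mul_zero]
    intro h'; rw [h'] at h; omega
  · have hs := sgn_spoke y x h.1.symm h.2
    refine ⟨0, 0, by simp [h.1], by rw [hs, neg_neg], Or.inr (Or.inr (Or.inr (Or.inl
      ⟨rfl, rfl, by rw [h.2]; push_cast; rfl, ?_⟩)))⟩
    rw [wt_spoke, mul_zero]
    intro h'; rw [h'] at h; omega
  · have hs := sgn_chord x y h.1 h.2.1 h.2.2.1 h.2.2.2
    refine ⟨0, 1, by simp [h], by rw [hs.1, hs.2], Or.inr (Or.inr (Or.inr (Or.inr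
      ⟨rfl, rfl, by simp [h.1], by simp [h.2.1], ?_⟩)))⟩
    rw [wt_chord x y h.2.2.1 h.2.2.2, mul_zero]
  · have hs := sgn_chord y x h.2.1 h.1 h.2.2.2 h.2.2.1
    refine ⟨0, 1, by rw [h.2.2.1, h.2.2.2]; decide, by rw [hs.1, hs.2]; rfl,
      Or.inr (Or.inr (Or.inr (Or.inr ⟨rfl, rfl, by simp [h.1], by simp [h.2.1], ?_⟩)))⟩
    rw [Sym2.eq_swap, wt_chord y x h.2.2.2 h.2.2.1, mul_zero]

set_option maxHeartbeats 4000000 in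
theorem four_cycle_arith (a b c d : ℤ) (d1 d2 d3 d4 c1 c2 c3 c4 e1 e2 e3 e4 : ℤ)
    (h : (6 : ℤ) ∣ d1 + d2 + d3 + d4 + 3 * (c1 + c2 + c3 + c4))
    (h1 : (d1 = 1 ∧ c1 = 0 ∧ b = a ∧ e1 = 1 + 3 * a) ∨
       (d1 = -1 ∧ c1 = 0 ∧ b = a ∧ e1 = -(1 + 3 * a)) ∨
       (d1 = 0 ∧ c1 = 0 ∧ b = a + 1 ∧ e1 = 0) ∨
       (d1 = 0 ∧ c1 = 0 ∧ a = b + 1 ∧ e1 = 0) ∨ (d1 = 0 ∧ c1 = 1 ∧ a = 0 ∧ b = 0 ∧ e1 = 0))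
    (h2 : (d2 = 1 ∧ c2 = 0 ∧ c = b ∧ e2 = 1 + 3 * b) ∨
       (d2 = -1 ∧ c2 = 0 ∧ c = b ∧ e2 = -(1 + 3 * b)) ∨
       (d2 = 0 ∧ c2 = 0 ∧ c = b + 1 ∧ e2 = 0) ∨
       (d2 = 0 ∧ c2 = 0 ∧ b = c + 1 ∧ e2 = 0) ∨ (d2 = 0 ∧ c2 = 1 ∧ b = 0 ∧ c = 0 ∧ e2 = 0))
    (h3 : (d3 = 1 ∧ c3 = 0 ∧ d = c ∧ e3 = 1 + 3 * c) ∨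
       (d3 = -1 ∧ c3 = 0 ∧ d = c ∧ e3 = -(1 + 3 * c)) ∨
       (d3 = 0 ∧ c3 = 0 ∧ d = c + 1 ∧ e3 = 0) ∨
       (d3 = 0 ∧ c3 = 0 ∧ c = d + 1 ∧ e3 = 0) ∨ (d3 = 0 ∧ c3 = 1 ∧ c = 0 ∧ d = 0 ∧ e3 = 0))
    (h4 : (d4 = 1 ∧ c4 = 0 ∧ a = d ∧ e4 = 1 + 3 * d) ∨
       (d4 = -1 ∧ c4 = 0 ∧ a = d ∧ e4 = -(1 + 3 * d)) ∨
       (d4 = 0 ∧ c4 = 0 ∧ a = d + 1 ∧ e4 = 0) ∨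
       (d4 = 0 ∧ c4 = 0 ∧ d = a + 1 ∧ e4 = 0) ∨ (d4 = 0 ∧ c4 = 1 ∧ d = 0 ∧ a = 0 ∧ e4 = 0)) :
    -3 ≤ e1 + e2 + e3 + e4 ∧ e1 + e2 + e3 + e4 ≤ 3 := by
  rcases h1 with ⟨rfl, rfl, h1⟩ | ⟨rfl, rfl, h1⟩ | ⟨rfl, rfl, h1⟩ | ⟨rfl, rfl, h1⟩ | ⟨rfl, rfl, h1⟩ <;>
  rcases h2 with ⟨rfl, rfl, h2⟩ | ⟨rfl, rfl, h2⟩ | ⟨rfl, rfl, h2⟩ | ⟨rfl, rfl, h2⟩ | ⟨rfl, rfl, h2⟩ <;>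
  rcases h3 with ⟨rfl, rfl, h3⟩ | ⟨rfl, rfl, h3⟩ | ⟨rfl, rfl, h3⟩ | ⟨rfl, rfl, h3⟩ | ⟨rfl, rfl, h3⟩ <;>
  rcases h4 with ⟨rfl, rfl, h4⟩ | ⟨rfl, rfl, h4⟩ | ⟨rfl, rfl, h4⟩ | ⟨rfl, rfl, h4⟩ | ⟨rfl, rfl, h4⟩ <;>
  omega

theorem switch_bound {k : ℕ} {u v u' v' : Fin k × ZMod 6} (a1 : (Web k).Adj u v)
    (a2 : (Web k).Adj v u') (a3 : (Web k).Adj u' v') (a4 : (Web k).Adj v' u) :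
    |wt s(u, v) + wt s(u', v') - wt s(u', v) - wt s(u, v')| ≤ 3 := by
  obtain ⟨d1, c1, j1, s1, k1⟩ := adj_form a1
  obtain ⟨d2, c2, j2, s2, k2⟩ := adj_form a2
  obtain ⟨d3, c3, j3, s3, k3⟩ := adj_form a3
  obtain ⟨d4, c4, j4, s4, k4⟩ := adj_form a4
  have hd : (6 : ℤ) ∣ d1 + d2 + d3 + d4 + 3 * (c1 + c2 + c3 + c4) := by
    rw [j3, j2, j1] at j4
    have : ((d1 + d2 + d3 + d4 + 3 * (c1 + c2 + c3 + c4) : ℤ) : ZMod 6) = 0 := by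
      push_cast at j4 ⊢
      linear_combination -j4
    exact (ZMod.intCast_zmod_eq_zero_iff_dvd _ 6).1 this
  have := four_cycle_arith _ _ _ _ d1 d2 d3 d4 c1 c2 c3 c4 _ _ _ _ hd k1 k2 k3 k4
  rw [s3, s2, s1, Sym2.eq_swap (a := v), Sym2.eq_swap (a := v')] at this
  rw [abs_le]
  rcases sgn_cases u with e | e <;> rw [e] at this <;> constructor <;> linarith [this.1, this.2]

theorem val_par : ∀ j : ZMod 6, (j + 1).val % 2 = (j.val + 1) % 2 := by decide

theorem webM_isPM (k p : ℕ) : IsPM (Web k) (WebM k p) := by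
  refine ⟨?_, ?_, ?_⟩
  · rintro e ⟨i, j, _, rfl⟩
    exact adj_ring (i, j)
  · rintro e ⟨i, j, h, rfl⟩ f ⟨i', j', h', rfl⟩ hne v ⟨hv, hv'⟩
    simp only [Sym2.mem_iff] at hv hv'
    have p1 := val_par j
    have p2 := val_par j'
    rcases hv with rfl | rfl <;> rcases hv' with e | e <;>
      simp only [Prod.mk.injEq] at e <;> obtain ⟨e1, e2⟩ := e <;> subst e1
    · subst e2; exact hne rfl
    · subst e2; omega
    · subst e2; omega
    · have := add_right_cancel e2
      subst this; exact hne rfl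
  · rintro ⟨i, j⟩
    by_cases h : ((i : ℕ) + j.val) % 2 = (p - 1) % 2
    · exact ⟨_, ⟨i, j, h, rfl⟩, by simp⟩
    · refine ⟨_, ⟨i, j - 1, ?_, rfl⟩, by simp⟩
      have := val_par (j - 1)
      rw [sub_add_cancel] at this
      omega

theorem ringE_mem_webM {k p : ℕ} (x : Fin k × ZMod 6) :
    ringE x ∈ WebM k p ↔ ((x.1 : ℕ) + x.2.val) % 2 = (p - 1) % 2 := by
  constructor
  · rintro ⟨i, j, h, e⟩
    have : ringE x = ringE (i, j) := e
    rw [ringE_inj] at this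
    rw [this]; exact h
  · intro h
    exact ⟨x.1, x.2, h, rfl⟩

theorem count_par (i r : ℕ) (hr : r < 2) :
    ∑ j : ZMod 6, (if (i + j.val) % 2 = r then (1 : ℤ) else 0) = 3 := by
  have : ∀ j : ZMod 6, (i + j.val) % 2 = (i % 2 + j.val) % 2 := by intro j; omega
  simp only [this]
  have h2 : i % 2 < 2 := Nat.mod_lt _ (by norm_num)
  generalize i % 2 = m at h2
  interval_cases m <;> interval_cases r <;> decide

theorem pot_webM1 (k : ℕ) : pot (WebM k 1) = ∑ i : Fin k, 3 * (1 + 3 * (i.val : ℤ)) := by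
  unfold pot
  rw [Fintype.sum_prod_type]
  apply Finset.sum_congr rfl
  intro i _
  generalize hc : (1 + 3 * (i.val : ℤ)) = c
  rw [← count_par i.val 0 (by norm_num), Finset.sum_mul]
  apply Finset.sum_congr rfl
  intro j _
  by_cases h : (i.val + j.val) % 2 = 0
  · rw [if_pos h, if_pos (by rw [ringE_mem_webM]; exact h), rw8, sgn, hc]
    simp only
    rw [Even.neg_one_pow (Nat.even_iff.2 h)]
  · rw [if_neg h, if_neg (by rw [ringE_mem_webM]; exact h), zero_mul]

theorem pot_webM2 (k : ℕ) : pot (WebM k 2) = - ∑ i : Fin k, 3 * (1 + 3 * (i.val : ℤ)) := by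
  unfold pot
  rw [Fintype.sum_prod_type, ← Finset.sum_neg_distrib]
  apply Finset.sum_congr rfl
  intro i _
  generalize hc : (1 + 3 * (i.val : ℤ)) = c
  rw [← count_par i.val 1 (by norm_num), Finset.sum_mul, ← Finset.sum_neg_distrib]
  apply Finset.sum_congr rfl
  intro j _
  by_cases h : (i.val + j.val) % 2 = 1
  · rw [if_pos h, if_pos (by rw [ringE_mem_webM]; exact h), rw8, sgn, hc]
    simp only
    rw [Odd.neg_one_pow (Nat.odd_iff.2 h)]; ring
  · rw [if_neg h, if_neg (by rw [ringE_mem_webM]; exact h), zero_mul, neg_zero]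

theorem sum_val (k : ℕ) : 2 * ∑ i : Fin k, 3 * (1 + 3 * (i.val : ℤ)) = 3 * (3 * k ^ 2 - k) := by
  rw [Fin.sum_univ_eq_sum_range (fun i => 3 * (1 + 3 * (i : ℤ))) k]
  induction k with
  | zero => simp
  | succ n ih =>
    rw [Finset.sum_range_succ, mul_add, ih]; push_cast; ring

theorem adj_pot {k : ℕ} {M N : {M : Set (Sym2 (Fin k × ZMod 6)) // IsPM (Web k) M}}
    (h : (TransGraph (Web k)).Adj M N) : |pot M.1 - pot N.1| ≤ 3 := by
  have key : ∀ M N : {M : Set (Sym2 (Fin k × ZMod 6)) // IsPM (Web k) M},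
      IsSwitch (Web k) M.1 N.1 → |pot M.1 - pot N.1| ≤ 3 := by
    rintro M N ⟨u, v, u', v', h1, h2, h3, h4, h5, h6, m1, m2, a1, a2, e⟩
    rw [e, pot_switch M.2 h1 h2 h3 h5 m1 m2]
    have := switch_bound (k := k) (M.2.1 m1) a1.symm (M.2.1 m2) a2.symm
    refine le_trans (le_of_eq ?_) this
    congr 1; ring
  unfold TransGraph at h
  rw [SimpleGraph.fromRel_adj] at h
  rcases h.2 with h | h
  · exact key _ _ h
  · rw [abs_sub_comm]; exact key _ _ h

theorem walk_pot {k : ℕ} {M N : {M : Set (Sym2 (Fin k × ZMod 6)) // IsPM (Web k) M}}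
    (p : (TransGraph (Web k)).Walk M N) : |pot M.1 - pot N.1| ≤ 3 * p.length := by
  induction p with
  | nil => simp
  | @cons u v w h p ih =>
    have h1 := adj_pot h
    have h2 := abs_sub_le (pot u.1) (pot v.1) (pot w.1)
    rw [SimpleGraph.Walk.length_cons]; push_cast
    linarith

theorem sgn_eq {k : ℕ} (x : Fin k × ZMod 6) :
    sgn x = (-1) ^ (x.2 + ((x.1 : ℕ) : ZMod 6)).val := by
  have : ∀ (i : ℕ) (j : ZMod 6), (-1 : ℤ) ^ (i + j.val) = (-1) ^ (j + (i : ZMod 6)).val := by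
    intro i j
    induction i with
    | zero => simp
    | succ i ih =>
      rw [Nat.cast_succ, ← add_assoc, pow_val_succ, ← ih]; ring
  exact this _ _

theorem flip_max {k : ℕ} (M : {M : Set (Sym2 (Fin k × ZMod 6)) // IsPM (Web k) M})
    (hmax : ∀ N, (TransGraph (Web k)).Adj M N → pot N.1 ≤ pot M.1)
    {u v u' v' : Fin k × ZMod 6} (h2 : u ≠ u') (h5 : v ≠ v')
    (m1 : s(u, v) ∈ M.1) (m2 : s(u', v') ∈ M.1)
    (a1 : (Web k).Adj u' v) (a2 : (Web k).Adj u v') :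
    wt s(u', v) + wt s(u, v') ≤ wt s(u, v) + wt s(u', v') := by
  have h1 : u ≠ v := (show (Web k).Adj u v from M.2.1 m1).ne
  have h6 : u' ≠ v' := (show (Web k).Adj u' v' from M.2.1 m2).ne
  have h3 : u ≠ v' := a2.ne
  have h4 : v ≠ u' := a1.ne.symm
  have hp := pot_switch M.2 h1 h2 h3 h5 m1 m2
  have hpm := switch_isPM M.2 h1 h2 h3 h4 h5 h6 m1 m2 a1 a2
  by_contra hlt
  have := hmax ⟨_, hpm⟩ (by
    unfold TransGraph
    rw [SimpleGraph.fromRel_adj]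
    refine ⟨fun e => ?_, Or.inl ⟨u, v, u', v', h1, h2, h3, h4, h5, h6, m1, m2, a1, a2, rfl⟩⟩
    have e' := congrArg (fun X => pot X.1) e
    simp only at e'
    rw [hp] at e'
    linarith)
  simp only at this
  rw [hp] at this
  linarith

/-- ring edge indicator in sheared coordinates -/
def RR {k : ℕ} (M : Set (Sym2 (Fin k × ZMod 6))) (i : ℕ) (t : ZMod 6) : Prop :=
  ∃ h : i < k, ringE (⟨i, h⟩, t - (i : ZMod 6)) ∈ M

/-- inward spoke (or chord) indicator in sheared coordinates -/
def YY {k : ℕ} (M : Set (Sym2 (Fin k × ZMod 6))) : ℕ → ZMod 6 → Prop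
  | 0, t => (t = 0 ∨ t = 3) ∧ ∃ h : 0 < k, s(((⟨0, h⟩ : Fin k), (0 : ZMod 6)), (⟨0, h⟩, 3)) ∈ M
  | i + 1, t => ∃ h : i + 1 < k,
      s(((⟨i, by omega⟩ : Fin k), t - ((i + 1 : ℕ) : ZMod 6)), (⟨i + 1, h⟩, t - ((i + 1 : ℕ) : ZMod 6))) ∈ M

theorem exOne_of {V : Type*} {G : SimpleGraph V} {M : Set (Sym2 V)} (hM : IsPM G M) (v : V)
    (P1 P2 P3 P4 : V → Prop)
    (hall : ∀ a, G.Adj v a → P1 a ∨ P2 a ∨ P3 a ∨ P4 a)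
    (hex : ∀ a, ¬ (P1 a ∧ P2 a) ∧ ¬ (P1 a ∧ P3 a) ∧ ¬ (P1 a ∧ P4 a) ∧ ¬ (P2 a ∧ P3 a) ∧
      ¬ (P2 a ∧ P4 a) ∧ ¬ (P3 a ∧ P4 a)) :
    ExOne (∃ a, s(v, a) ∈ M ∧ P1 a) (∃ a, s(v, a) ∈ M ∧ P2 a) (∃ a, s(v, a) ∈ M ∧ P3 a)
      (∃ a, s(v, a) ∈ M ∧ P4 a) := by
  have ex : ∀ P Q : V → Prop, (∀ a, ¬ (P a ∧ Q a)) →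
      ¬ ((∃ a, s(v, a) ∈ M ∧ P a) ∧ (∃ a, s(v, a) ∈ M ∧ Q a)) := by
    rintro P Q h ⟨⟨a, ha, pa⟩, ⟨b, hb, qb⟩⟩
    have := pm_unique' hM ha hb
    subst this
    exact h a ⟨pa, qb⟩
  refine ⟨?_, ex _ _ fun a => (hex a).1, ex _ _ fun a => (hex a).2.1, ex _ _ fun a => (hex a).2.2.1,
    ex _ _ fun a => (hex a).2.2.2.1, ex _ _ fun a => (hex a).2.2.2.2.1,
    ex _ _ fun a => (hex a).2.2.2.2.2⟩
  obtain ⟨e, he, hv⟩ := hM.2.2 v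
  obtain ⟨a, rfl⟩ := Sym2.mem_iff_exists.1 hv
  rcases hall a (hM.1 he) with h | h | h | h
  · exact Or.inl ⟨a, he, h⟩
  · exact Or.inr (Or.inl ⟨a, he, h⟩)
  · exact Or.inr (Or.inr (Or.inl ⟨a, he, h⟩))
  · exact Or.inr (Or.inr (Or.inr ⟨a, he, h⟩))

theorem z03 : ¬ ((0 : ZMod 6) = 3) := by decide
theorem z031 : ¬ ((3 : ZMod 6) = 0 + 1) := by decide
theorem z301 : ¬ ((0 : ZMod 6) = 3 + 1) := by decide

theorem cover {k : ℕ} {M : Set (Sym2 (Fin k × ZMod 6))} (hM : IsPM (Web k) M) (i : ℕ) (hi : i < k)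
    (t : ZMod 6) : ExOne (RR M i t) (RR M i (t - 1)) (YY M i t) (YY M (i + 1) (t + 1)) := by
  obtain ⟨j, hj⟩ : ∃ j, j = t - (i : ZMod 6) := ⟨_, rfl⟩
  have main := exOne_of hM ((⟨i, hi⟩ : Fin k), j)
    (fun a => (a.1 : ℕ) = i ∧ a.2 = j + 1) (fun a => (a.1 : ℕ) = i ∧ j = a.2 + 1)
    (fun a => (i = a.1 + 1 ∧ a.2 = j) ∨
      ((a.1 : ℕ) = 0 ∧ i = 0 ∧ ((j = 0 ∧ a.2 = 3) ∨ (j = 3 ∧ a.2 = 0))))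
    (fun a => (a.1 : ℕ) = i + 1 ∧ a.2 = j) ?_ ?_
  · have e1 : RR M i t ↔ ∃ a, s(((⟨i, hi⟩ : Fin k), j), a) ∈ M ∧ ((a.1 : ℕ) = i ∧ a.2 = j + 1) := by
      constructor
      · rintro ⟨_, h⟩
        rw [← hj] at h
        exact ⟨_, h, rfl, rfl⟩
      · rintro ⟨⟨a1, a2⟩, h, h1, h2⟩
        simp only at h1 h2
        have : a1 = ⟨i, hi⟩ := Fin.ext h1
        subst this h2
        refine ⟨hi, ?_⟩
        rw [← hj]; exact h
    have e2 : RR M i (t - 1) ↔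
        ∃ a, s(((⟨i, hi⟩ : Fin k), j), a) ∈ M ∧ ((a.1 : ℕ) = i ∧ j = a.2 + 1) := by
      have hj' : t - 1 - (i : ZMod 6) = j - 1 := by rw [hj]; ring
      constructor
      · rintro ⟨_, h⟩
        rw [hj', ringE, Sym2.eq_swap] at h
        simp only [sub_add_cancel] at h
        exact ⟨_, h, rfl, by simp⟩
      · rintro ⟨⟨a1, a2⟩, h, h1, h2⟩
        simp only at h1 h2
        have : a1 = ⟨i, hi⟩ := Fin.ext h1
        subst this
        refine ⟨hi, ?_⟩
        rw [hj', h2, ringE, Sym2.eq_swap]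
        simp only [add_sub_cancel_right]
        rw [← h2]; exact h
    have e4 : YY M (i + 1) (t + 1) ↔
        ∃ a, s(((⟨i, hi⟩ : Fin k), j), a) ∈ M ∧ ((a.1 : ℕ) = i + 1 ∧ a.2 = j) := by
      have hj' : t + 1 - ((i + 1 : ℕ) : ZMod 6) = j := by rw [hj]; push_cast; ring
      constructor
      · rintro ⟨_, h⟩
        rw [hj'] at h
        exact ⟨_, h, rfl, rfl⟩
      · rintro ⟨⟨a1, a2⟩, h, h1, h2⟩
        simp only at h1 h2
        have hk : i + 1 < k := by rw [← h1]; exact a1.2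
        have : a1 = ⟨i + 1, hk⟩ := Fin.ext h1
        subst this h2
        refine ⟨hk, ?_⟩
        rw [hj']; exact h
    have e3 : YY M i t ↔ ∃ a, s(((⟨i, hi⟩ : Fin k), j), a) ∈ M ∧ ((i = a.1 + 1 ∧ a.2 = j) ∨
      ((a.1 : ℕ) = 0 ∧ i = 0 ∧ ((j = 0 ∧ a.2 = 3) ∨ (j = 3 ∧ a.2 = 0)))) := by
      cases i with
      | zero =>
        have ht : j = t := by rw [hj]; simp
        subst ht
        constructor
        · rintro ⟨rfl | rfl, h0, h⟩
          · exact ⟨_, h, Or.inr ⟨rfl, rfl, Or.inl ⟨rfl, rfl⟩⟩⟩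
          · rw [Sym2.eq_swap] at h
            exact ⟨_, h, Or.inr ⟨rfl, rfl, Or.inr ⟨rfl, rfl⟩⟩⟩
        · rintro ⟨⟨a1, a2⟩, h, h1 | ⟨h1, _, ⟨h2, h3⟩ | ⟨h2, h3⟩⟩⟩
          · exact absurd h1.1 (by simp)
          · simp only at h1 h3
            have : a1 = ⟨0, hi⟩ := Fin.ext h1
            subst this h2 h3
            exact ⟨Or.inl rfl, hi, h⟩
          · simp only at h1 h3
            have : a1 = ⟨0, hi⟩ := Fin.ext h1
            subst this h2 h3
            rw [Sym2.eq_swap] at h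
            exact ⟨Or.inr rfl, hi, h⟩
      | succ i =>
        constructor
        · rintro ⟨_, h⟩
          rw [← hj, Sym2.eq_swap] at h
          exact ⟨_, h, Or.inl ⟨rfl, rfl⟩⟩
        · rintro ⟨⟨a1, a2⟩, h, ⟨h1, h2⟩ | h1⟩
          · simp only at h1 h2
            have hi' : i < k := by omega
            have : a1 = ⟨i, hi'⟩ := Fin.ext (by simp only; omega)
            subst this h2
            refine ⟨hi, ?_⟩
            rw [← hj, Sym2.eq_swap]; exact h
          · exact absurd h1.2.1 (by simp)
    rw [e1, e2, e3, e4]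
    exact main
  · rintro ⟨a1, a2⟩ ha
    rcases web_adj ha with h | h | h | h | h | h
    · exact Or.inl ⟨(congrArg Fin.val h.1).symm, h.2⟩
    · exact Or.inr (Or.inl ⟨(congrArg Fin.val h.1).symm, h.2⟩)
    · exact Or.inr (Or.inr (Or.inr ⟨h.2, h.1.symm⟩))
    · exact Or.inr (Or.inr (Or.inl (Or.inl ⟨h.2, h.1.symm⟩)))
    · exact Or.inr (Or.inr (Or.inl (Or.inr ⟨h.2.1, h.1, Or.inl h.2.2⟩)))
    · exact Or.inr (Or.inr (Or.inl (Or.inr ⟨h.2.1, h.1, Or.inr h.2.2⟩)))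
  · rintro ⟨a1, a2⟩
    simp only
    refine ⟨?_, ?_, ?_, ?_, ?_, ?_⟩
    · rintro ⟨⟨_, rfl⟩, _, h⟩; exact zne2 _ h.symm
    · rintro ⟨⟨h1, rfl⟩, h | ⟨_, _, ⟨rfl, h⟩ | ⟨rfl, h⟩⟩⟩
      · omega
      · revert h; decide
      · revert h; decide
    · rintro ⟨h, h'⟩; omega
    · rintro ⟨⟨h1, rfl⟩, h | ⟨_, _, ⟨h, rfl⟩ | ⟨h, rfl⟩⟩⟩
      · omega
      · revert h; decide
      · revert h; decide
    · rintro ⟨h, h'⟩; omega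
    · rintro ⟨h | h, h'⟩ <;> omega

theorem pow_even : ∀ s : ZMod 6, s = 0 ∨ s = 2 ∨ s = 4 → (-1 : ℤ) ^ s.val = 1 := by decide

theorem two_mul_even : ∀ s : ZMod 6, 2 * s = 0 ∨ 2 * s = 2 ∨ 2 * s = 4 := by decide

theorem even03 : ∀ s : ZMod 6, s = 0 ∨ s = 2 ∨ s = 4 → (s = 0 ∨ s = 3) →
    (s + 1 = 0 ∨ s + 1 = 3) → False := by decide

theorem rw8_zero {k : ℕ} (h0 : 0 < k) (j : ZMod 6) :
    rw8 ((⟨0, h0⟩ : Fin k), j) = (-1) ^ j.val := by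
  unfold rw8 sgn; simp

theorem max_top {k : ℕ} (M : {M : Set (Sym2 (Fin k × ZMod 6)) // IsPM (Web k) M})
    (hmax : ∀ N, (TransGraph (Web k)).Adj M N → pot N.1 ≤ pot M.1) : WebM k 1 = M.1 := by
  have hfl := @flip_max k M hmax
  have top := noflip_top k (RR M.1) (YY M.1) (cover M.2) ?_ ?_ ?_ ?_ ?_ ?_ ?_ ?_
  · apply pm_subset_eq M.2 (webM_isPM k 1)
    rintro e ⟨i, j, h, rfl⟩
    have hs : (j + ((i : ℕ) : ZMod 6)) = 0 ∨ (j + ((i : ℕ) : ZMod 6)) = 2 ∨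
        (j + ((i : ℕ) : ZMod 6)) = 4 := by
      obtain ⟨n, hn⟩ := Nat.even_iff.2 (show ((i : ℕ) + j.val) % 2 = 0 from h)
      have : j + ((i : ℕ) : ZMod 6) = 2 * (n : ZMod 6) := by
        have h1 := congrArg (Nat.cast : ℕ → ZMod 6) hn
        push_cast at h1
        rw [ZMod.natCast_zmod_val] at h1
        rw [add_comm, h1]; ring
      rw [this]; exact two_mul_even _
    obtain ⟨_, hm⟩ := top i i.2 _ hs
    rw [add_sub_cancel_right] at hm
    exact hm
  · intro t h
    cases k with
    | zero => obtain ⟨_, h0, _⟩ := h; exact absurd h0 (lt_irrefl _)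
    | succ k => obtain ⟨h0, _⟩ := h; exact absurd h0 (lt_irrefl _)
  · rintro (_ | i) s hs ⟨h1, h2⟩
    · have h1 := h1.1
      have h2 := h2.1
      exact even03 s hs h1 h2
    · obtain ⟨hk, m1⟩ := h1
      obtain ⟨_, m2⟩ := h2
      obtain ⟨j, hj⟩ : ∃ j, j = s - ((i + 1 : ℕ) : ZMod 6) := ⟨_, rfl⟩
      have hj' : s + 1 - ((i + 1 : ℕ) : ZMod 6) = j + 1 := by rw [hj]; ring
      rw [← hj] at m1
      rw [hj', Sym2.eq_swap] at m2
      have := hfl (fun h => zne1 j (congrArg Prod.snd h).symm)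
        (fun h => zne1 j (congrArg Prod.snd h).symm) m1 m2
        (adj_ring ((⟨i+1, hk⟩ : Fin k), j)).symm (adj_ring ((⟨i, by omega⟩ : Fin k), j))
      have s1 : sgn ((⟨i+1, hk⟩ : Fin k), j) = 1 := by
        rw [sgn_eq]; simp only
        rw [hj, sub_add_cancel]; exact pow_even s hs
      have s2 := sgn_spoke ((⟨i, by omega⟩ : Fin k), j) ((⟨i+1, hk⟩ : Fin k), j) rfl rfl
      have w1 := wt_ring ((⟨i+1, hk⟩ : Fin k), j)
      have w2 := wt_ring ((⟨i, by omega⟩ : Fin k), j)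
      rw [ringE, rw8] at w1 w2
      rw [Sym2.eq_swap, w1, w2, wt_spoke _ _ (by simp), wt_spoke _ _ (by simp)] at this
      rw [s1] at s2 this
      have s3 : sgn ((⟨i, by omega⟩ : Fin k), j) = -1 := by linarith
      rw [s3] at this
      push_cast at this
      linarith
  · rintro i s hs ⟨⟨_, m1⟩, ⟨hk, m2⟩⟩
    obtain ⟨j, hj⟩ : ∃ j, j = s - (i : ZMod 6) := ⟨_, rfl⟩
    have hj' : s + 1 - ((i + 1 : ℕ) : ZMod 6) = j := by rw [hj]; push_cast; ring
    rw [← hj] at m1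
    rw [hj'] at m2
    have hne : ((⟨i, by omega⟩ : Fin k)) ≠ ⟨i + 1, hk⟩ := by simp
    have m2' : s(((⟨i + 1, hk⟩ : Fin k), j + 1), (⟨i + 1, hk⟩, j)) ∈ M.1 := by
      rw [Sym2.eq_swap]; exact m2
    have := hfl (fun h => hne (congrArg Prod.fst h)) (fun h => hne (congrArg Prod.fst h)) m1 m2'
      (adj_spoke ((⟨i, by omega⟩ : Fin k), j + 1) (⟨i + 1, hk⟩, j + 1) rfl rfl).symm
      (adj_spoke ((⟨i, by omega⟩ : Fin k), j) (⟨i + 1, hk⟩, j) rfl rfl)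
    have s1 : sgn ((⟨i, by omega⟩ : Fin k), j) = 1 := by
      rw [sgn_eq]; simp only
      rw [hj, sub_add_cancel]; exact pow_even s hs
    have s2 := sgn_spoke ((⟨i, by omega⟩ : Fin k), j) ((⟨i+1, hk⟩ : Fin k), j) rfl rfl
    have w1 := wt_ring ((⟨i+1, hk⟩ : Fin k), j)
    have w2 := wt_ring ((⟨i, by omega⟩ : Fin k), j)
    rw [ringE, rw8] at w1 w2
    rw [wt_spoke _ _ (by simp), wt_spoke _ _ (by simp), w2,
      Sym2.eq_swap (a := ((⟨i + 1, hk⟩ : Fin k), j + 1)), w1, s2, s1] at this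
    push_cast at this
    linarith
  · rintro ⟨h, _⟩; revert h; decide
  · rintro ⟨h, _⟩; revert h; decide
  · rintro ⟨h, _⟩; revert h; decide
  · rintro ⟨⟨h0, m1⟩, ⟨_, _, m2⟩⟩
    rw [Nat.cast_zero, sub_zero] at m1
    rw [Sym2.eq_swap] at m2
    have w0 := wt_ring ((⟨0, h0⟩ : Fin k), 0)
    have w1 := wt_ring ((⟨0, h0⟩ : Fin k), 1)
    have w2 := wt_ring ((⟨0, h0⟩ : Fin k), 2)
    have wc := wt_chord ((⟨0, h0⟩ : Fin k), 0) ((⟨0, h0⟩ : Fin k), 3) rfl rfl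
    have e0 : rw8 ((⟨0, h0⟩ : Fin k), 0) = 1 := (rw8_zero h0 0).trans (by decide)
    have e1 : rw8 ((⟨0, h0⟩ : Fin k), 1) = -1 := (rw8_zero h0 1).trans (by decide)
    have e2 : rw8 ((⟨0, h0⟩ : Fin k), 2) = 1 := (rw8_zero h0 2).trans (by decide)
    have a0 := adj_ring ((⟨0, h0⟩ : Fin k), 0)
    have a2 := adj_ring ((⟨0, h0⟩ : Fin k), 2)
    have := hfl (fun h => (by decide : (1 : ZMod 6) ≠ 3) (congrArg Prod.snd h))
      (fun h => (by decide : (1 + 1 : ZMod 6) ≠ 0) (congrArg Prod.snd h)) m1 m2 a2.symm a0.symm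
    have f0 : wt s(((⟨0, h0⟩ : Fin k), (1 : ZMod 6)), (⟨0, h0⟩, 0)) = 1 := by
      rw [Sym2.eq_swap]; exact w0.trans e0
    have f1 : wt s(((⟨0, h0⟩ : Fin k), (1 : ZMod 6)), (⟨0, h0⟩, 2)) = -1 := w1.trans e1
    have f2 : wt s(((⟨0, h0⟩ : Fin k), (3 : ZMod 6)), (⟨0, h0⟩, 2)) = 1 := by
      rw [Sym2.eq_swap]; exact w2.trans e2
    have fc : wt s(((⟨0, h0⟩ : Fin k), (3 : ZMod 6)), (⟨0, h0⟩, 0)) = 0 := by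
      rw [Sym2.eq_swap]; exact wc
    have this' : wt s(((⟨0, h0⟩ : Fin k), (3 : ZMod 6)), (⟨0, h0⟩, 2)) +
      wt s(((⟨0, h0⟩ : Fin k), (1 : ZMod 6)), (⟨0, h0⟩, 0)) ≤
      wt s(((⟨0, h0⟩ : Fin k), (1 : ZMod 6)), (⟨0, h0⟩, 2)) +
      wt s(((⟨0, h0⟩ : Fin k), (3 : ZMod 6)), (⟨0, h0⟩, 0)) := this
    rw [f0, f1, f2, fc] at this'
    norm_num at this'
  · rintro ⟨⟨h0, m1⟩, ⟨_, m2⟩⟩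
    rw [Nat.cast_zero, sub_zero] at m1 m2
    have w3 := wt_ring ((⟨0, h0⟩ : Fin k), 3)
    have w4 := wt_ring ((⟨0, h0⟩ : Fin k), 4)
    have w5 := wt_ring ((⟨0, h0⟩ : Fin k), 5)
    have wc := wt_chord ((⟨0, h0⟩ : Fin k), 0) ((⟨0, h0⟩ : Fin k), 3) rfl rfl
    have e3 : rw8 ((⟨0, h0⟩ : Fin k), 3) = -1 := (rw8_zero h0 3).trans (by decide)
    have e4 : rw8 ((⟨0, h0⟩ : Fin k), 4) = 1 := (rw8_zero h0 4).trans (by decide)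
    have e5 : rw8 ((⟨0, h0⟩ : Fin k), 5) = -1 := (rw8_zero h0 5).trans (by decide)
    have a4 := adj_ring ((⟨0, h0⟩ : Fin k), 4)
    have ac := adj_chord ((⟨0, h0⟩ : Fin k), 0) ((⟨0, h0⟩ : Fin k), 3) rfl rfl rfl rfl
    have m1' : s(((⟨0, h0⟩ : Fin k), (3 : ZMod 6)), (⟨0, h0⟩, 4)) ∈ M.1 := m1
    have m2' : s(((⟨0, h0⟩ : Fin k), (5 : ZMod 6)), (⟨0, h0⟩, 0)) ∈ M.1 := m2
    have this' := hfl (fun h => (by decide : (3 : ZMod 6) ≠ 5) (congrArg Prod.snd h))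
      (fun h => (by decide : (4 : ZMod 6) ≠ 0) (congrArg Prod.snd h)) m1' m2' a4.symm ac.symm
    have f3 : wt s(((⟨0, h0⟩ : Fin k), (3 : ZMod 6)), (⟨0, h0⟩, 4)) = -1 := w3.trans e3
    have f4 : wt s(((⟨0, h0⟩ : Fin k), (5 : ZMod 6)), (⟨0, h0⟩, 4)) = 1 := by
      rw [Sym2.eq_swap]; exact w4.trans e4
    have f5 : wt s(((⟨0, h0⟩ : Fin k), (5 : ZMod 6)), (⟨0, h0⟩, 0)) = -1 := w5.trans e5
    have fc : wt s(((⟨0, h0⟩ : Fin k), (3 : ZMod 6)), (⟨0, h0⟩, 0)) = 0 := by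
      rw [Sym2.eq_swap]; exact wc
    rw [f3, f4, f5, fc] at this'
    norm_num at this'

theorem reach_top {k : ℕ} (M : {M : Set (Sym2 (Fin k × ZMod 6)) // IsPM (Web k) M}) :
    (TransGraph (Web k)).Reachable M ⟨WebM k 1, webM_isPM k 1⟩ := by
  have : Finite {M : Set (Sym2 (Fin k × ZMod 6)) // IsPM (Web k) M} := inferInstance
  obtain ⟨N, hN, hmax⟩ := Set.exists_max_image {N | (TransGraph (Web k)).Reachable M N}
    (fun N => pot N.1) (Set.toFinite _) ⟨M, SimpleGraph.Reachable.refl M⟩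
  have : WebM k 1 = N.1 := max_top N fun N' h => hmax N' (SimpleGraph.Reachable.trans hN h.reachable)
  have e : N = ⟨WebM k 1, webM_isPM k 1⟩ := Subtype.ext this.symm
  rw [← e]; exact hN

/-- There is a sequence of graphs on `n` vertices whose
transition graphs are connected of diameter `Ω(n²)`: for every `k ≥ 1`, the
spider's web `W_k` has `n = 6 * k` vertices, its transition graph is
connected, and its diameter is at least `n * (n - 2) / 12`. -/
theorem web_transGraph_diam_quadratic (k : ℕ) (hk : 1 ≤ k) :
    Fintype.card (Fin k × ZMod 6) = 6 * k ∧
    (TransGraph (Web k)).Connected ∧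
    6 * k * (6 * k - 2) / 12 ≤ (TransGraph (Web k)).diam := by
  have : Finite {M : Set (Sym2 (Fin k × ZMod 6)) // IsPM (Web k) M} := inferInstance
  have hne : Nonempty {M : Set (Sym2 (Fin k × ZMod 6)) // IsPM (Web k) M} :=
    ⟨⟨WebM k 1, webM_isPM k 1⟩⟩
  have hc : (TransGraph (Web k)).Connected :=
    ⟨fun M N => (reach_top M).trans (reach_top N).symm⟩
  refine ⟨?_, hc, ?_⟩
  · rw [Fintype.card_prod, Fintype.card_fin, ZMod.card, mul_comm]
  · have hd := SimpleGraph.dist_le_diam (SimpleGraph.connected_iff_ediam_ne_top.1 hc)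
      (u := ⟨WebM k 1, webM_isPM k 1⟩) (v := ⟨WebM k 2, webM_isPM k 2⟩)
    obtain ⟨p, hp⟩ := hc.exists_walk_length_eq_dist
      ⟨WebM k 1, webM_isPM k 1⟩ ⟨WebM k 2, webM_isPM k 2⟩
    have hw := walk_pot p
    simp only at hw
    rw [pot_webM1, pot_webM2, hp] at hw
    have h1 := le_trans (le_abs_self _) hw
    have h2 := sum_val k
    refine le_trans ?_ hd
    generalize (TransGraph (Web k)).dist _ _ = D at *
    obtain ⟨m, rfl⟩ : ∃ m, k = m + 1 := ⟨k - 1, by omega⟩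
    have h3 : (3 * (m + 1) ^ 2 - (m + 1) : ℤ) ≤ D := by
      push_cast at h1 h2
      linarith
    have e : 6 * (m + 1) * (6 * (m + 1) - 2) = 12 * ((m + 1) * (3 * m + 2)) := by
      have : 6 * (m + 1) - 2 = 6 * m + 4 := by omega
      rw [this]; ring
    rw [e, Nat.mul_div_cancel_left _ (by norm_num)]
    zify
    linarith
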